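/- Let F₃ : ℝ³ → ℝ³ be F₃(t,x,v) = (−x·v, 0, t·v). There is no differentiable curve γ : ℝ → ℝ³, defined on all of ℝ, with γ(0) = (2, 1, −2) and γ'(s) = F₃(γ(s)) for every s ∈ ℝ. (Hence the left-invariant Lorentzian metric on Aff(ℝ) × ℝ determined by q₃ is geodesically incomplete.) -/

import Mathlib

/-- The Euler–Arnold field `F₃(t,x,v) = (−x·v, 0, t·v)`. -/
def F3 : ℝ × ℝ × ℝ → ℝ × ℝ × ℝ :=
  fun p => (-(p.2.1 * p.2.2), 0, p.1 * p.2.2)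

/-- The Riccati equation `f' = c f²` with `c > 0` has no global solution with `f 0 > 0`. -/
theorem not_forall_hasDerivAt_const_mul_sq {f : ℝ → ℝ} {c : ℝ} (hc : 0 < c) (h0 : 0 < f 0) :
    ¬ ∀ s, HasDerivAt f (c * f s ^ 2) s := by
  intro hf
  have hmono : Monotone f :=
    monotone_of_deriv_nonneg (fun s => (hf s).differentiableAt) fun s => by
      rw [(hf s).deriv]; positivity
  have hpos : ∀ s, 0 ≤ s → 0 < f s := fun s hs => h0.trans_le (hmono hs)
  have hderiv : ∀ s, 0 ≤ s → HasDerivAt (fun r => (f r)⁻¹ + c * r) 0 s := fun s hs => by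
    have hne : f s ≠ 0 := (hpos s hs).ne'
    refine (((hf s).fun_inv hne).add ((hasDerivAt_id s).const_mul c)).congr_deriv ?_
    field_simp
    ring
  have hT : 0 ≤ (c * f 0)⁻¹ := by positivity
  have hconst := constant_of_has_deriv_right_zero
    (fun s hs => (hderiv s hs.1).continuousAt.continuousWithinAt)
    (fun s hs => (hderiv s hs.1).hasDerivWithinAt) _ (Set.right_mem_Icc.mpr hT)
  have hval : c * (c * f 0)⁻¹ = (f 0)⁻¹ := by field_simp
  have hinv : 0 < (f (c * f 0)⁻¹)⁻¹ := inv_pos.mpr (hpos _ hT)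
  simp only [hval, mul_zero, add_zero] at hconst
  linarith

/-- There is no globally defined integral curve of `F₃` through `(2, 1, −2)`:
the left invariant Lorentzian metric on `Aff(ℝ) × ℝ` determined by `q₃` is
geodesically incomplete. -/
theorem no_global_euler_arnold_solution_dim3 :
    ¬ ∃ γ : ℝ → ℝ × ℝ × ℝ,
        γ 0 = (2, 1, -2) ∧ ∀ s : ℝ, HasDerivAt γ (F3 (γ s)) s := by
  rintro ⟨γ, h0, hγ⟩
  have ht : ∀ s, HasDerivAt (fun r => (γ r).1) (-((γ s).2.1 * (γ s).2.2)) s := fun s =>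
    (hγ s).fst
  have hx : ∀ s, HasDerivAt (fun r => (γ r).2.1) 0 s := fun s => (hγ s).snd.fst
  have hv : ∀ s, HasDerivAt (fun r => (γ r).2.2) ((γ s).1 * (γ s).2.2) s := fun s =>
    (hγ s).snd.snd
  have hx1 : ∀ s, (γ s).2.1 = 1 := fun s => by
    have := is_const_of_deriv_eq_zero (fun r => (hx r).differentiableAt)
      (fun r => (hx r).deriv) s 0
    simpa [h0] using this
  have hq : ∀ s, HasDerivAt (fun r => (γ r).1 ^ 2 + 2 * (γ r).2.2) 0 s := fun s => by
    refine (((ht s).fun_pow 2).add ((hv s).const_mul 2)).congr_deriv ?_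
    rw [hx1 s]
    push_cast
    ring
  have hq0 : ∀ s, (γ s).1 ^ 2 + 2 * (γ s).2.2 = 0 := fun s => by
    have := is_const_of_deriv_eq_zero (fun r => (hq r).differentiableAt)
      (fun r => (hq r).deriv) s 0
    norm_num [h0] at this
    exact this
  refine not_forall_hasDerivAt_const_mul_sq (f := fun r => (γ r).1) (c := 1 / 2)
    (by norm_num) (by simp [h0]) fun s => ?_
  refine (ht s).congr_deriv ?_
  rw [hx1 s]
  linarith [hq0 s]
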